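/- Let α, β > 0 with α ≠ β, and suppose that either α ≤ 1 < β or α > 1 ≥ β. Then the two-parameter generalized Rényi entropy of the Poisson distribution, λ ↦ H_GR(α,β,λ), is strictly increasing on (0,∞). -/

import Mathlib

open Real Filter Topology

/-- The Poisson probabilities `p_i(λ) = e^{-λ} λ^i / i!`. -/
noncomputable def poissonP (l : ℝ) (i : ℕ) : ℝ :=
  Real.exp (-l) * l ^ i / (Nat.factorial i)

/-- `ψ(α,λ) = ∑_{i=0}^∞ (p_i(λ))^α`. -/
noncomputable def psiPoisson (α l : ℝ) : ℝ :=
  ∑' i, (poissonP l i) ^ α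

open Finset.HasAntidiagonal (antidiagonal)

lemma poissonP_pos {l : ℝ} (hl : 0 < l) (i : ℕ) : 0 < poissonP l i := by
  unfold poissonP
  positivity

lemma hasSum_poissonP (l : ℝ) : HasSum (poissonP l) 1 := by
  have h := (NormedSpace.expSeries_div_hasSum_exp (𝔸 := ℝ) l).mul_left (Real.exp (-l))
  rw [← Real.exp_eq_exp_ℝ, ← Real.exp_add, neg_add_cancel, Real.exp_zero] at h
  exact (funext fun i => mul_div_assoc _ _ _ : poissonP l = _) ▸ h

lemma poissonP_succ (l : ℝ) (i : ℕ) : poissonP l (i + 1) = poissonP l i * (l / (i + 1)) := by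
  have h : (i.factorial : ℝ) ≠ 0 := by positivity
  simp only [poissonP, Nat.factorial_succ]
  push_cast
  field_simp
  ring

/-- The family of Poisson distributions is closed under convolution. -/
lemma poissonP_add (l m : ℝ) (n : ℕ) :
    poissonP (l + m) n = ∑ k ∈ antidiagonal n, poissonP l k.1 * poissonP m k.2 := by
  rw [poissonP, (Commute.all l m).add_pow', neg_add, Real.exp_add, Finset.mul_sum,
    Finset.sum_div]
  refine Finset.sum_congr rfl fun k hk => ?_
  obtain rfl := Finset.HasAntidiagonal.mem_antidiagonal.mp hk
  have h : ((k.1 + k.2).choose k.1 : ℝ) * k.1.factorial * k.2.factorial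
      = (k.1 + k.2).factorial := by
    rw [Nat.choose_symm_add]
    exact_mod_cast Nat.add_choose_mul_factorial_mul_factorial k.1 k.2
  have h1 : (k.1.factorial : ℝ) ≠ 0 := by positivity
  have h2 : (k.2.factorial : ℝ) ≠ 0 := by positivity
  have h3 : ((k.1 + k.2).factorial : ℝ) ≠ 0 := by positivity
  simp only [poissonP, nsmul_eq_mul]
  field_simp
  linear_combination l ^ k.1 * m ^ k.2 * h

lemma summable_poissonP_rpow {α l : ℝ} (hα : 0 < α) (hl : 0 < l) :
    Summable fun i => poissonP l i ^ α := by
  refine summable_of_ratio_test_tendsto_lt_one zero_lt_one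
    (.of_forall fun i => (rpow_pos_of_pos (poissonP_pos hl i) α).ne') ?_
  have h : Tendsto (fun i : ℕ => (l / ((i : ℝ) + 1)) ^ α) atTop (𝓝 0) := by
    have h0 : Tendsto (fun i : ℕ => l / ((i : ℝ) + 1)) atTop (𝓝 0) :=
      tendsto_const_nhds.div_atTop
        (tendsto_atTop_add_const_right _ _ tendsto_natCast_atTop_atTop)
    simpa [Real.zero_rpow hα.ne'] using h0.rpow_const (.inr hα.le)
  refine h.congr fun i => ?_
  have hp := poissonP_pos hl i
  have hr : 0 < l / ((i : ℝ) + 1) := by positivity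
  rw [poissonP_succ, mul_rpow hp.le hr.le, norm_of_nonneg (by positivity),
    norm_of_nonneg (by positivity), mul_div_cancel_left₀ _ (by positivity)]

lemma psiPoisson_pos {α l : ℝ} (hα : 0 < α) (hl : 0 < l) : 0 < psiPoisson α l :=
  (summable_poissonP_rpow hα hl).tsum_pos (fun i => rpow_nonneg (poissonP_pos hl i).le α) 0
    (rpow_pos_of_pos (poissonP_pos hl 0) α)

lemma psiPoisson_one (l : ℝ) : psiPoisson 1 l = 1 := by
  simp [psiPoisson, (hasSum_poissonP l).tsum_eq]

/-- `ψ(α,λ)` as the total mass of the convolution of a Poisson distribution with `(p_i(λ))^α`. -/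
lemma hasSum_antidiagonal_poissonP_rpow {α l : ℝ} (hα : 0 < α) (hl : 0 < l) (m : ℝ) :
    HasSum (fun n => ∑ k ∈ antidiagonal n, poissonP m k.1 * poissonP l k.2 ^ α)
      (psiPoisson α l) := by
  have h1 : Summable fun i => ‖poissonP m i‖ := (hasSum_poissonP m).summable.norm
  have h2 : Summable fun i => ‖poissonP l i ^ α‖ := (summable_poissonP_rpow hα hl).norm
  have h3 := tsum_mul_tsum_eq_tsum_sum_antidiagonal_of_summable_norm h1 h2
  rw [(hasSum_poissonP m).tsum_eq, one_mul] at h3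
  rw [psiPoisson, h3]
  exact (summable_norm_sum_mul_antidiagonal_of_summable_norm h1 h2).of_norm.hasSum

lemma sum_antidiagonal_poissonP_fst_le_one {m : ℝ} (hm : 0 < m) (n : ℕ) :
    ∑ k ∈ antidiagonal n, poissonP m k.1 ≤ 1 := by
  rw [Finset.Nat.sum_antidiagonal_eq_sum_range_succ fun i _ => poissonP m i]
  exact sum_le_hasSum _ (fun i _ => (poissonP_pos hm i).le) (hasSum_poissonP m)

lemma poissonP_zero_lt_one {m : ℝ} (hm : 0 < m) : poissonP m 0 < 1 := by
  simpa [poissonP] using hm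

lemma psiPoisson_strictAntiOn {α : ℝ} (hα : 1 < α) :
    StrictAntiOn (psiPoisson α) (Set.Ioi 0) := by
  intro l hl l' _ hll'
  obtain ⟨m, hm, rfl⟩ : ∃ m, 0 < m ∧ l' = m + l := ⟨l' - l, by linarith, by ring⟩
  replace hl : 0 < l := hl
  have hα0 : 0 < α := by linarith
  refine hasSum_lt (i := 0) (fun n => ?_) ?_
    (summable_poissonP_rpow hα0 (add_pos hm hl)).hasSum
    (hasSum_antidiagonal_poissonP_rpow hα0 hl m)
  · have h := (convexOn_rpow hα.le).map_add_sum_le (t := antidiagonal n)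
      (w := fun k => poissonP m k.1) (p := fun k => poissonP l k.2)
      (v := 1 - ∑ k ∈ antidiagonal n, poissonP m k.1) (q := 0)
      (fun k _ => (poissonP_pos hm k.1).le) (sub_add_cancel _ _)
      (fun k _ => (poissonP_pos hl k.2).le)
      (sub_nonneg.mpr (sum_antidiagonal_poissonP_fst_le_one hm n)) Set.self_mem_Ici
    simpa [poissonP_add, Real.zero_rpow hα0.ne'] using h
  · have hp := poissonP_pos hm 0
    simp only [poissonP_add, Finset.Nat.antidiagonal_zero, Finset.sum_singleton]
    rw [mul_rpow hp.le (poissonP_pos hl 0).le]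
    exact mul_lt_mul_of_pos_right (rpow_lt_self_of_lt_one hp (poissonP_zero_lt_one hm) hα)
      (rpow_pos_of_pos (poissonP_pos hl 0) α)

lemma psiPoisson_strictMonoOn {α : ℝ} (hα0 : 0 < α) (hα : α < 1) :
    StrictMonoOn (psiPoisson α) (Set.Ioi 0) := by
  intro l hl l' _ hll'
  obtain ⟨m, hm, rfl⟩ : ∃ m, 0 < m ∧ l' = m + l := ⟨l' - l, by linarith, by ring⟩
  replace hl : 0 < l := hl
  refine hasSum_lt (i := 0) (fun n => ?_) ?_
    (hasSum_antidiagonal_poissonP_rpow hα0 hl m)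
    (summable_poissonP_rpow hα0 (add_pos hm hl)).hasSum
  · have h := (concaveOn_rpow hα0.le hα.le).map_add_sum_le (t := antidiagonal n)
      (w := fun k => poissonP m k.1) (p := fun k => poissonP l k.2)
      (v := 1 - ∑ k ∈ antidiagonal n, poissonP m k.1) (q := 0)
      (fun k _ => (poissonP_pos hm k.1).le) (sub_add_cancel _ _)
      (fun k _ => (poissonP_pos hl k.2).le)
      (sub_nonneg.mpr (sum_antidiagonal_poissonP_fst_le_one hm n)) Set.self_mem_Ici
    simpa [poissonP_add, Real.zero_rpow hα0.ne'] using h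
  · have hp := poissonP_pos hm 0
    simp only [poissonP_add, Finset.Nat.antidiagonal_zero, Finset.sum_singleton]
    rw [mul_rpow hp.le (poissonP_pos hl 0).le]
    exact mul_lt_mul_of_pos_right (self_lt_rpow_of_lt_one hp (poissonP_zero_lt_one hm) hα)
      (rpow_pos_of_pos (poissonP_pos hl 0) α)

lemma psiPoisson_monotoneOn {α : ℝ} (hα0 : 0 < α) (hα : α ≤ 1) :
    MonotoneOn (psiPoisson α) (Set.Ioi 0) := by
  rcases hα.eq_or_lt with rfl | hα
  · simpa only [funext psiPoisson_one] using monotoneOn_const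
  · exact (psiPoisson_strictMonoOn hα0 hα).monotoneOn

lemma log_psiPoisson_div_strictMonoOn {α β : ℝ} (hα : 0 < α) (hα1 : α ≤ 1) (hβ : 1 < β) :
    StrictMonoOn (fun l => Real.log (psiPoisson α l / psiPoisson β l)) (Set.Ioi 0) := by
  intro l hl m hm hlm
  have hβ0 : 0 < β := by linarith
  exact log_lt_log (div_pos (psiPoisson_pos hα hl) (psiPoisson_pos hβ0 hl))
    (div_lt_div₀' (psiPoisson_monotoneOn hα hα1 hl hm hlm.le)
      (psiPoisson_strictAntiOn hβ hl hm hlm) (psiPoisson_pos hα hm) (psiPoisson_pos hβ0 hm))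

/-- the two-parameter generalized Rényi entropy of the Poisson
distribution is strictly increasing in λ when α ≤ 1 < β or α > 1 ≥ β. -/
theorem genRenyi2_poisson_strictMono (α β : ℝ) (hα : 0 < α) (hβ : 0 < β)
    (hαβ : α ≠ β) (h : (α ≤ 1 ∧ 1 < β) ∨ (1 < α ∧ β ≤ 1)) :
    StrictMonoOn
      (fun l : ℝ => (β - α)⁻¹ * Real.log (psiPoisson α l / psiPoisson β l))
      (Set.Ioi (0 : ℝ)) := by
  rcases h with ⟨h1, h2⟩ | ⟨h1, h2⟩
  · intro l hl m hm hlm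
    exact mul_lt_mul_of_pos_left (log_psiPoisson_div_strictMonoOn hα h1 h2 hl hm hlm)
      (inv_pos.mpr (by linarith))
  · intro l hl m hm hlm
    have h := log_psiPoisson_div_strictMonoOn hβ h2 h1 hl hm hlm
    simp only [← inv_div (psiPoisson β _) (psiPoisson α _), Real.log_inv]
    exact mul_lt_mul_of_neg_left (neg_lt_neg h) (inv_lt_zero.mpr (by linarith))
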